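/- Let (A,R) be a pseudoinvolutive cotriangular Hopf algebra over k with Drinfeld element u. Let V and W be finite-dimensional right A-comodules with V positive and W negative (or V negative and W positive). Then every short exact sequence of right A-comodules 0 → V → U → W → 0 splits, i.e. U is isomorphic as a right A-comodule to V ⊕ W. -/

import Mathlib

open TensorProduct LinearMap

noncomputable section

universe u
variable {k A : Type u} [Field k] [Ring A] [HopfAlgebra k A]

/-- The convolution product on `Hom_k(A, k)`:  `(f ∗ g)(a) = Σ f(a₁) g(a₂)`. -/
def conv1 (f g : A →ₗ[k] k) : A →ₗ[k] k :=
  mul' k k ∘ₗ map f g ∘ₗ Coalgebra.comul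

/-- The convolution product on `Hom_k(A ⊗ A, k)` (using the tensor-product coalgebra
structure of `A ⊗ A`):  `(f ∗ g)(a ⊗ b) = Σ f(a₁ ⊗ b₁) g(a₂ ⊗ b₂)`. -/
def conv2 (f g : A ⊗[k] A →ₗ[k] k) : A ⊗[k] A →ₗ[k] k :=
  mul' k k ∘ₗ map f g ∘ₗ (Coalgebra.comul : A ⊗[k] A →ₗ[k] (A ⊗[k] A) ⊗[k] (A ⊗[k] A))

/-- The counit of the coalgebra `A ⊗ A`, i.e. `a ⊗ b ↦ ε(a) ε(b)`; this is the unit of the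
convolution algebra `(A ⊗ A)*`. -/
def eps2 : A ⊗[k] A →ₗ[k] k := (Coalgebra.counit : A ⊗[k] A →ₗ[k] k)

/-- Coquasitriangularity of a linear form `R : A ⊗ A → k` with respect to a (possibly
twisted) multiplication `m` on the underlying coalgebra of `A` (with the same unit `1`):
`R` is convolution invertible and
`R(m(a⊗b) ⊗ c) = Σ R(a⊗c₁) R(b⊗c₂)`, `R(a ⊗ m(b⊗c)) = Σ R(a₁⊗c) R(a₂⊗b)`,
`R(a⊗1) = ε(a) = R(1⊗a)`, and `Σ m(b₁⊗a₁) R(a₂⊗b₂) = Σ R(a₁⊗b₁) m(a₂⊗b₂)`. -/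
structure IsCQT (m : A ⊗[k] A →ₗ[k] A) (R : A ⊗[k] A →ₗ[k] k) : Prop where
  conv_invertible : ∃ Rinv, conv2 R Rinv = eps2 ∧ conv2 Rinv R = eps2
  mul_left : R ∘ₗ map m LinearMap.id =
    mul' k k ∘ₗ map R R ∘ₗ (tensorTensorTensorComm k A A A A).toLinearMap ∘ₗ
      map LinearMap.id Coalgebra.comul
  mul_right : R ∘ₗ map LinearMap.id m =
    mul' k k ∘ₗ map R R ∘ₗ (tensorTensorTensorComm k A A A A).toLinearMap ∘ₗ
      map LinearMap.id (TensorProduct.comm k A A).toLinearMap ∘ₗ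
      map Coalgebra.comul LinearMap.id
  unit_right : ∀ a : A, R (a ⊗ₜ 1) = Coalgebra.counit a
  unit_left : ∀ a : A, R (1 ⊗ₜ a) = Coalgebra.counit a
  comm_rel : (TensorProduct.rid k A).toLinearMap ∘ₗ
      map (m ∘ₗ (TensorProduct.comm k A A).toLinearMap) R ∘ₗ
      (Coalgebra.comul : A ⊗[k] A →ₗ[k] (A ⊗[k] A) ⊗[k] (A ⊗[k] A)) =
    (TensorProduct.lid k A).toLinearMap ∘ₗ map R m ∘ₗ
      (Coalgebra.comul : A ⊗[k] A →ₗ[k] (A ⊗[k] A) ⊗[k] (A ⊗[k] A))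

/-- Cotriangularity: coquasitriangular, and the convolution inverse of `R` is `R ∘ τ`. -/
structure IsCT (m : A ⊗[k] A →ₗ[k] A) (R : A ⊗[k] A →ₗ[k] k) extends IsCQT m R : Prop where
  tri_right : conv2 R (R ∘ₗ (TensorProduct.comm k A A).toLinearMap) = eps2
  tri_left : conv2 (R ∘ₗ (TensorProduct.comm k A A).toLinearMap) R = eps2

/-- The Drinfeld element `u ∈ A*`, `u(a) = Σ R(a₂ ⊗ S(a₁))`. -/
def drinfeld (R : A ⊗[k] A →ₗ[k] k) : A →ₗ[k] k :=
  R ∘ₗ map LinearMap.id (HopfAlgebra.antipode (R := k)) ∘ₗ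
    (TensorProduct.comm k A A).toLinearMap ∘ₗ Coalgebra.comul

/-- `ρ` makes `V` into a right `A`-comodule:  `(ρ ⊗ id) ∘ ρ = (id ⊗ Δ) ∘ ρ` and
`(id ⊗ ε) ∘ ρ = id`. -/
structure IsComod (V : Type u) [AddCommGroup V] [Module k V]
    (ρ : V →ₗ[k] V ⊗[k] A) : Prop where
  coassoc : (TensorProduct.assoc k V A A).toLinearMap ∘ₗ map ρ LinearMap.id ∘ₗ ρ =
    map LinearMap.id Coalgebra.comul ∘ₗ ρ
  counit_id : (TensorProduct.rid k V).toLinearMap ∘ₗ map LinearMap.id Coalgebra.counit ∘ₗ ρ =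
    LinearMap.id

/-- The endomorphism `f|_V : v ↦ (id ⊗ f)(ρ(v))` of a right `A`-comodule `(V, ρ)` attached to a
linear form `f ∈ A*`. -/
def coact {V : Type u} [AddCommGroup V] [Module k V] (ρ : V →ₗ[k] V ⊗[k] A)
    (f : A →ₗ[k] k) : V →ₗ[k] V :=
  (TensorProduct.rid k V).toLinearMap ∘ₗ map LinearMap.id f ∘ₗ ρ

/-- Pseudoinvolutivity: `tr(S²|_C) = dim C` for every finite-dimensional subcoalgebra `C ⊆ A`. -/
def Pseudoinvolutive (k A : Type u) [Field k] [Ring A] [HopfAlgebra k A] : Prop :=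
  ∀ C : Submodule k A, FiniteDimensional k C →
    (∀ c ∈ C, Coalgebra.comul c ∈ LinearMap.range (map C.subtype C.subtype)) →
    ∀ h : ∀ x ∈ C, (HopfAlgebra.antipode (R := k) ∘ₗ HopfAlgebra.antipode (R := k)) x ∈ C,
      trace k C ((HopfAlgebra.antipode (R := k) ∘ₗ HopfAlgebra.antipode (R := k)).restrict h) =
        (Module.finrank k C : k)

/-- `c ∈ A*` is a grouplike element of the dual, i.e. an algebra homomorphism `A → k`. -/
def IsGrouplikeForm (c : A →ₗ[k] k) : Prop :=
  c 1 = 1 ∧ ∀ a b : A, c (a * b) = c a * c b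

/-- `c` is central in the convolution algebra `A*`. -/
def IsConvCentral (c : A →ₗ[k] k) : Prop :=
  ∀ f : A →ₗ[k] k, conv1 c f = conv1 f c

/-- The linear form `a ⊗ b ↦ f(a) g(b)` on `A ⊗ A`. -/
def pairForm (f g : A →ₗ[k] k) : A ⊗[k] A →ₗ[k] k := mul' k k ∘ₗ map f g

/-- The cotriangular structure
`R_c = ½ (ε⊗ε + ε⊗c + c⊗ε − c⊗c)` attached to a central grouplike `c ∈ A*` of order `≤ 2`. -/
def Rc (c : A →ₗ[k] k) : A ⊗[k] A →ₗ[k] k :=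
  (2⁻¹ : k) • (pairForm Coalgebra.counit Coalgebra.counit + pairForm Coalgebra.counit c +
    pairForm c Coalgebra.counit - pairForm c c)

/-- A submodule `W ≤ V` is a subcomodule of the comodule `(V, ρ)`. -/
def IsSubcomod {V : Type u} [AddCommGroup V] [Module k V] (ρ : V →ₗ[k] V ⊗[k] A)
    (W : Submodule k V) : Prop :=
  ∀ w ∈ W, ρ w ∈ LinearMap.range (map W.subtype (LinearMap.id : A →ₗ[k] A))

/-- A linear map between comodules is a comodule morphism. -/
def IsComodMap {V W : Type u} [AddCommGroup V] [Module k V] [AddCommGroup W] [Module k W]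
    (ρV : V →ₗ[k] V ⊗[k] A) (ρW : W →ₗ[k] W ⊗[k] A) (f : V →ₗ[k] W) : Prop :=
  ρW ∘ₗ f = map f LinearMap.id ∘ₗ ρV

/-- The linear form `a ↦ Σ R(a₁ ⊗ S(a₂))`, which is the convolution inverse of the Drinfeld
element of a cotriangular Hopf algebra. -/
def drinfeldInv (R : A ⊗[k] A →ₗ[k] k) : A →ₗ[k] k :=
  R ∘ₗ map LinearMap.id (HopfAlgebra.antipode (R := k)) ∘ₗ Coalgebra.comul

/-- A square matrix over a Hopf algebra is multiplicative if its entries are the matrix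
coefficients of a comodule: `Δ(tᵢⱼ) = ∑ tᵢₗ ⊗ tₗⱼ` and `ε(tᵢⱼ) = δᵢⱼ`. -/
structure IsMultiplicativeMatrix {n : Type*} [Fintype n] [DecidableEq n] (t : Matrix n n A) :
    Prop where
  comul_apply : ∀ i j, Coalgebra.comul (R := k) (t i j) = ∑ l, t i l ⊗ₜ[k] t l j
  counit_apply : ∀ i j, Coalgebra.counit (R := k) (t i j) = (1 : Matrix n n k) i j

namespace IsMultiplicativeMatrix

open HopfAlgebra

variable {n m : Type*} [Fintype n] [DecidableEq n] [Fintype m] [DecidableEq m]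
  {t : Matrix n n A} {s : Matrix m m A}

lemma sum_mul_antipode (ht : IsMultiplicativeMatrix (k := k) t) (i j : n) :
    ∑ l, t i l * antipode k (t l j) = algebraMap k A ((1 : Matrix n n k) i j) := by
  have h := mul_antipode_lTensor_comul_apply (R := k) (t i j)
  simpa [ht.comul_apply, ht.counit_apply] using h

lemma sum_antipode_mul (ht : IsMultiplicativeMatrix (k := k) t) (i j : n) :
    ∑ l, antipode k (t i l) * t l j = algebraMap k A ((1 : Matrix n n k) i j) := by
  have h := mul_antipode_rTensor_comul_apply (R := k) (t i j)
  simpa [ht.comul_apply, ht.counit_apply] using h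

lemma comul_antipode_apply (ht : IsMultiplicativeMatrix (k := k) t) (i j : n) :
    Coalgebra.comul (R := k) (antipode k (t i j)) =
      ∑ l, antipode k (t l j) ⊗ₜ[k] antipode k (t i l) := by
  let X : Matrix n n (A ⊗[k] A) := .of fun i j => Coalgebra.comul (R := k) (t i j)
  let Y : Matrix n n (A ⊗[k] A) := .of fun i j => Coalgebra.comul (R := k) (antipode k (t i j))
  let Z : Matrix n n (A ⊗[k] A) :=
    .of fun i j => ∑ l, antipode k (t l j) ⊗ₜ[k] antipode k (t i l)
  have hXY : X * Y = 1 := by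
    ext i j
    simp only [X, Y, Matrix.mul_apply, Matrix.of_apply, ← Bialgebra.comul_mul, ← map_sum,
      ht.sum_mul_antipode, Matrix.one_apply]
    split_ifs <;> simp
  have hZX : Z * X = 1 := by
    ext i j
    simp only [X, Z, Matrix.mul_apply, Matrix.of_apply, ht.comul_apply, Finset.sum_mul_sum,
      Algebra.TensorProduct.tmul_mul_tmul]
    rw [Finset.sum_comm]
    have (r : n) : ∑ l, ∑ q, (antipode k (t r l) * t l q) ⊗ₜ[k] (antipode k (t i r) * t q j) =
        (1 : A) ⊗ₜ[k] (antipode k (t i r) * t r j) := by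
      rw [Finset.sum_comm]
      simp_rw [← sum_tmul, ht.sum_antipode_mul, Matrix.one_apply]
      rw [Finset.sum_eq_single r] <;> simp +contextual [eq_comm]
    simp_rw [this, ← tmul_sum, ht.sum_antipode_mul, Matrix.one_apply]
    split_ifs <;> simp [Algebra.TensorProduct.one_def]
  exact congr_fun₂ (left_inv_eq_right_inv hZX hXY).symm i j

/-- The matrix coefficients of the dual comodule. -/
lemma dual (ht : IsMultiplicativeMatrix (k := k) t) :
    IsMultiplicativeMatrix (k := k) (.of fun i j => antipode k (t j i) : Matrix n n A) where
  comul_apply i j := by simpa using ht.comul_antipode_apply j i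
  counit_apply i j := by simp [ht.counit_apply, Matrix.one_apply, eq_comm]

lemma comul_tmul (ht : IsMultiplicativeMatrix (k := k) t) (hs : IsMultiplicativeMatrix (k := k) s)
    (i j : n) (p q : m) :
    (Coalgebra.comul (R := k) (t i j ⊗ₜ[k] s p q)) =
      ∑ l, ∑ r, (t i l ⊗ₜ[k] s p r) ⊗ₜ[k] (t l j ⊗ₜ[k] s r q) := by
  simp only [TensorProduct.comul_tmul, ht.comul_apply, hs.comul_apply, sum_tmul, tmul_sum,
    map_sum, AlgebraTensorModule.tensorTensorTensorComm_tmul]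
  exact Finset.sum_comm

lemma cotriangular_apply_antipode {R : A ⊗[k] A →ₗ[k] k} (hR : IsCT (mul' k A) R)
    (ht : IsMultiplicativeMatrix (k := k) t) (hs : IsMultiplicativeMatrix (k := k) s)
    (i j : n) (p q : m) :
    R (antipode k (t i j) ⊗ₜ s p q) = R (s p q ⊗ₜ t i j) := by
  let X : Matrix (n × m) (n × m) k := .of fun a b => R (t a.1 b.1 ⊗ₜ s a.2 b.2)
  let Y : Matrix (n × m) (n × m) k := .of fun a b => R (antipode k (t a.1 b.1) ⊗ₜ s a.2 b.2)
  let Z : Matrix (n × m) (n × m) k := .of fun a b => R (s a.2 b.2 ⊗ₜ t a.1 b.1)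
  have hZX : Z * X = 1 := by
    ext a b
    have h := congr($(hR.tri_left) (t a.1 b.1 ⊗ₜ s a.2 b.2))
    simp only [conv2, coe_comp, Function.comp_apply, ht.comul_tmul hs, map_sum, eps2] at h
    simpa [Z, X, Matrix.mul_apply, Fintype.sum_prod_type, ht.counit_apply, hs.counit_apply,
      Matrix.one_apply, Prod.ext_iff, ite_and] using h
  have hXY : X * Y = 1 := by
    ext a b
    have h (l : n) := congr($(hR.mul_left) ((t a.1 l ⊗ₜ antipode k (t l b.1)) ⊗ₜ s a.2 b.2))
    simp only [coe_comp, Function.comp_apply, map_tmul, hs.comul_apply, tmul_sum, map_sum,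
      mul'_apply, id_coe, id_eq] at h
    have h2 := Finset.sum_congr (rfl : (Finset.univ : Finset n) = _) fun l _ => h l
    rw [← map_sum, ← sum_tmul, ht.sum_mul_antipode] at h2
    simp only [X, Y, Matrix.mul_apply, Fintype.sum_prod_type, Matrix.of_apply]
    simp only [LinearEquiv.coe_coe, tensorTensorTensorComm_tmul, map_tmul, mul'_apply] at h2
    rw [← h2]
    simp only [Algebra.algebraMap_eq_smul_one, ← smul_tmul', map_smul, hR.unit_left,
      hs.counit_apply, Matrix.one_apply, Prod.ext_iff, ite_and]
    split_ifs <;> simp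
  exact congr_fun₂ (left_inv_eq_right_inv hZX hXY).symm (i, p) (j, q)

lemma drinfeld_apply (R : A ⊗[k] A →ₗ[k] k) (ht : IsMultiplicativeMatrix (k := k) t) (i j : n) :
    drinfeld R (t i j) = ∑ l, R (t l j ⊗ₜ antipode k (t i l)) := by
  simp [drinfeld, ht.comul_apply]

lemma drinfeldInv_apply (R : A ⊗[k] A →ₗ[k] k) (ht : IsMultiplicativeMatrix (k := k) t)
    (i j : n) : drinfeldInv R (t i j) = ∑ l, R (t i l ⊗ₜ antipode k (t l j)) := by
  simp [drinfeldInv, ht.comul_apply]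

lemma sum_drinfeld_smul_mul_antipode {R : A ⊗[k] A →ₗ[k] k} (hR : IsCT (mul' k A) R)
    (ht : IsMultiplicativeMatrix (k := k) t) (p j : n) :
    ∑ l, ∑ r, drinfeld R (t r l) • (t l j * antipode k (t p r)) =
      algebraMap k A (drinfeld R (t p j)) := by
  have h (i : n) := congr($(hR.comm_rel) (t i j ⊗ₜ antipode k (t p i)))
  have hd (i : n) := ht.comul_tmul ht.dual i j i p
  simp only [Matrix.of_apply] at hd
  simp only [coe_comp, Function.comp_apply, hd, map_sum, LinearEquiv.coe_coe, map_tmul,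
    mul'_apply, comm_tmul, rid_tmul, lid_tmul] at h
  have h2 := Finset.sum_congr (rfl : (Finset.univ : Finset n) = _) fun i _ => h i
  simp only [ht.drinfeld_apply, Finset.sum_smul, map_sum]
  calc _ = ∑ i, ∑ l, ∑ r, R (t i l ⊗ₜ antipode k (t r i)) • (t l j * antipode k (t p r)) := by
        rw [Finset.sum_comm]
        conv_rhs => rw [Finset.sum_comm]; enter [2, l]; rw [Finset.sum_comm]
        rw [Finset.sum_comm]
    _ = _ := by
        rw [← h2]
        have (l r : n) : ∑ i, R (t l j ⊗ₜ antipode k (t p r)) • (antipode k (t r i) * t i l) =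
            R (t l j ⊗ₜ antipode k (t p r)) • algebraMap k A ((1 : Matrix n n k) r l) := by
          rw [← Finset.smul_sum, ht.sum_antipode_mul]
        rw [Finset.sum_comm]
        conv_lhs => enter [2, l]; rw [Finset.sum_comm]
        simp_rw [this, Matrix.one_apply]
        simp [apply_ite (algebraMap k A), Algebra.algebraMap_eq_smul_one]

/-- The Drinfeld element implements the square of the antipode. -/
lemma sum_drinfeld_smul {R : A ⊗[k] A →ₗ[k] k} (hR : IsCT (mul' k A) R)
    (ht : IsMultiplicativeMatrix (k := k) t) (i j : n) :
    ∑ l, drinfeld R (t i l) • t l j =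
      ∑ l, drinfeld R (t l j) • antipode k (antipode k (t i l)) := by
  have h (p : n) := congr($(ht.sum_drinfeld_smul_mul_antipode hR p j) *
    antipode k (antipode k (t i p)))
  have h2 := Finset.sum_congr (rfl : (Finset.univ : Finset n) = _) fun p _ => h p
  simp only [Finset.sum_mul, smul_mul_assoc, mul_assoc, ← antipode_mul_antidistrib,
    Algebra.algebraMap_eq_smul_one, one_mul] at h2
  rw [← h2, Finset.sum_comm]
  refine Finset.sum_congr rfl fun l _ => ?_
  rw [Finset.sum_comm]
  simp_rw [← Finset.smul_sum, ← Finset.mul_sum, ← map_sum, ht.sum_antipode_mul,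
    Matrix.one_apply]
  rw [Finset.sum_eq_single i] <;> simp +contextual [eq_comm, antipode_one]

lemma sum_drinfeld_mul_drinfeldInv {R : A ⊗[k] A →ₗ[k] k} (hR : IsCT (mul' k A) R)
    (ht : IsMultiplicativeMatrix (k := k) t) (i j : n) :
    ∑ l, drinfeld R (t i l) * drinfeldInv R (t l j) = (1 : Matrix n n k) i j := by
  have hS (a b c d : n) : R (antipode k (antipode k (t a b)) ⊗ₜ antipode k (t c d)) =
      R (t c d ⊗ₜ t a b) := by
    have h1 := ht.dual.cotriangular_apply_antipode hR ht.dual b a d c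
    have h2 := ht.cotriangular_apply_antipode hR ht.dual c d b a
    have h3 := ht.cotriangular_apply_antipode hR ht a b c d
    simp only [Matrix.of_apply] at h1 h2
    rw [h1, h2, h3]
  calc _ = ∑ m, R ((∑ l, drinfeld R (t i l) • t l m) ⊗ₜ antipode k (t m j)) := by
        simp only [ht.drinfeldInv_apply, Finset.mul_sum, sum_tmul, map_sum, ← smul_tmul',
          map_smul, smul_eq_mul]
        exact Finset.sum_comm
    _ = ∑ m, ∑ l, ∑ r, R (t r m ⊗ₜ antipode k (t l r)) * R (t m j ⊗ₜ t i l) := by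
        simp_rw [ht.sum_drinfeld_smul hR]
        simp only [sum_tmul, map_sum, ← smul_tmul', map_smul,
          smul_eq_mul, hS, ht.drinfeld_apply, Finset.sum_mul]
    _ = ∑ r, ∑ l, ∑ m, R (t r m ⊗ₜ antipode k (t l r)) * R (t m j ⊗ₜ t i l) := by
        rw [Finset.sum_comm]
        conv_rhs => rw [Finset.sum_comm]; enter [2, l]; rw [Finset.sum_comm]
    _ = ∑ r, R (t r j ⊗ₜ ∑ l, t i l * antipode k (t l r)) := by
        refine Finset.sum_congr rfl fun r _ => ?_
        rw [tmul_sum, map_sum]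
        refine Finset.sum_congr rfl fun l _ => ?_
        have h := congr($(hR.mul_right) (t r j ⊗ₜ (t i l ⊗ₜ antipode k (t l r))))
        simpa [ht.comul_apply, sum_tmul] using h.symm
    _ = _ := by
        simp_rw [ht.sum_mul_antipode]
        rw [Finset.sum_eq_single i]
        · simp [hR.unit_right, ht.counit_apply]
        · simp +contextual [eq_comm]
        · simp

end IsMultiplicativeMatrix

section TraceForms

variable {K : Type*} [Field K]

lemma Matrix.traceForm_eq_zero_of_trace_eq_zero {n : Type*} [Fintype n] [DecidableEq n]
    [CharZero K] (θ : Matrix n n K →ₗ[K] K) (hθ : ∀ x y, θ (x * y) = θ (y * x))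
    {x : Matrix n n K} (hx : x.trace = 0) : θ x = 0 := by
  have hne {i j : n} (h : i ≠ j) : θ (Matrix.single i j 1) = 0 := by
    have := hθ (Matrix.single i i 1) (Matrix.single i j 1)
    simpa [Matrix.single_mul_single_of_ne, h.symm] using this
  have heq (i j : n) : θ (Matrix.single i i 1) = θ (Matrix.single j j 1) := by
    have := hθ (Matrix.single i j 1) (Matrix.single j i 1)
    simpa using this
  rcases isEmpty_or_nonempty n with _ | ⟨⟨o⟩⟩
  · rw [Subsingleton.elim x 0, map_zero]
  have key : θ x = ∑ i, x i i * θ (Matrix.single o o 1) := by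
    conv_lhs => rw [Matrix.matrix_eq_sum_single x]
    simp only [map_sum]
    refine Finset.sum_congr rfl fun i _ => ?_
    have (j : n) : θ (Matrix.single i j (x i j)) = x i j * θ (Matrix.single i j 1) := by
      rw [← smul_eq_mul, ← map_smul, Matrix.smul_single, smul_eq_mul, mul_one]
    simp_rw [this]
    rw [Finset.sum_eq_single i, heq i o]
    · intro j _ hj
      rw [hne hj.symm, mul_zero]
    · simp
  rw [key, ← Finset.sum_mul]
  simp only [Matrix.trace, Matrix.diag_apply] at hx
  rw [hx, zero_mul]

lemma Matrix.traceForm_pi_eq {ι : Type*} [Fintype ι] [DecidableEq ι] [CharZero K]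
    {n : ι → Type*} [∀ i, Fintype (n i)] [∀ i, DecidableEq (n i)]
    (θ : (∀ i, Matrix (n i) (n i) K) →ₗ[K] K) (hθ : ∀ x y, θ (x * y) = θ (y * x))
    {x y : ∀ i, Matrix (n i) (n i) K} (hxy : ∀ i, (x i).trace = (y i).trace) : θ x = θ y := by
  rw [← sub_eq_zero, ← map_sub,
    ← LinearMap.sum_single_apply (fun i => Matrix (n i) (n i) K) (x - y), map_sum]
  refine Finset.sum_eq_zero fun i _ => ?_
  refine Matrix.traceForm_eq_zero_of_trace_eq_zero
    (θ ∘ₗ LinearMap.single K (fun i => Matrix (n i) (n i) K) i)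
    (fun a b => ?_) (x := (x - y) i) ?_
  · simp only [coe_comp, Function.comp_apply, LinearMap.coe_single, Pi.single_mul, hθ]
  · simp [Matrix.trace_sub, hxy]

lemma Matrix.trace_mulLeft_comp_mulRight {n : Type*} [Fintype n] [DecidableEq n]
    (x y : Matrix n n K) :
    LinearMap.trace K _ (mulLeft K x ∘ₗ mulRight K y) = x.trace * y.trace := by
  rw [LinearMap.trace_eq_matrix_trace K (Matrix.stdBasis K n n), Matrix.trace,
    Fintype.sum_prod_type]
  simp only [Matrix.diag_apply, LinearMap.toMatrix_apply, Matrix.trace, Finset.sum_mul_sum]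
  refine Finset.sum_congr rfl fun i _ => Finset.sum_congr rfl fun j _ => ?_
  rw [Matrix.stdBasis_eq_single]
  have (M : Matrix n n K) : (Matrix.stdBasis K n n).repr M (i, j) = M i j := by
    simp [Matrix.stdBasis]
  rw [this]
  simp [Matrix.mul_apply, Matrix.single_apply, ite_and]

variable {B : Type*} [Ring B] [Algebra K B]

/-- If a linear form `θ` on `B` satisfies `θ(xy) = θ(yx)` and vanishes on nilpotent elements, then
it takes the same value on `g` as on the involution `2e - 1`, where `e` lifts the central idempotent
of `B / rad B` cutting out the simple modules on which `g` has positive trace. -/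
lemma exists_isIdempotentElem_traceForm_eq [IsAlgClosed K] [CharZero K] [FiniteDimensional K B]
    (g g' : B)
    (hsimple : ∀ (d : ℕ) (φ : B →ₐ[K] Matrix (Fin d) (Fin d) K), Function.Surjective φ →
      (φ g).trace * (φ g').trace = d * d)
    (hinv : ∀ θ : B →ₗ[K] K, (∀ x y, θ (x * y) = θ (y * x)) → θ g = θ g') :
    ∃ e : B, IsIdempotentElem e ∧ ∀ θ : B →ₗ[K] K, (∀ x y, θ (x * y) = θ (y * x)) →
      (∀ x, IsNilpotent x → θ x = 0) → θ g = θ (2 * e - 1) := by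
  have : IsArtinianRing B := IsArtinianRing.of_finite K B
  obtain ⟨n, d, hd, ⟨Φ⟩⟩ :=
    IsSemisimpleRing.exists_algEquiv_pi_matrix_of_isAlgClosed K (B ⧸ Ring.jacobson B)
  let q : B →ₐ[K] ∀ i, Matrix (Fin (d i)) (Fin (d i)) K :=
    Φ.toAlgHom.comp (Ideal.Quotient.mkₐ K (Ring.jacobson B))
  have hq : Function.Surjective q := Φ.surjective.comp Ideal.Quotient.mk_surjective
  have hnil (x : B) (hx : q x = 0) : IsNilpotent x := by
    have hx' : x ∈ Ring.jacobson B := by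
      have : Ideal.Quotient.mk (Ring.jacobson B) x = 0 := Φ.injective (by simpa [q] using hx)
      rwa [Ideal.Quotient.eq_zero_iff_mem] at this
    obtain ⟨N, hN⟩ := IsSemiprimaryRing.isNilpotent (R := B)
    exact ⟨N, by simpa [hN] using Ideal.pow_mem_pow hx' N⟩
  let χ (i : Fin n) : B →ₗ[K] K :=
    Matrix.traceLinearMap _ K K ∘ₗ LinearMap.proj i ∘ₗ q.toLinearMap
  have hsign (i : Fin n) : (q g i).trace = d i ∨ (q g i).trace = -d i := by
    have h1 : (q g i).trace = (q g' i).trace :=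
      hinv (χ i) fun x y => by simp [χ, Matrix.trace_mul_comm (q x i)]
    have h2 := hsimple (d i) ((Pi.evalAlgHom K _ i).comp q)
      ((Function.surjective_eval i).comp hq)
    simp only [AlgHom.comp_apply, Pi.evalAlgHom_apply, ← h1] at h2
    exact mul_self_eq_mul_self_iff.mp h2
  classical
  let E : ∀ i, Matrix (Fin (d i)) (Fin (d i)) K := fun i => if (q g i).trace = d i then 1 else 0
  have hE : IsIdempotentElem E := by
    ext1 i
    simp only [E, Pi.mul_apply]
    split_ifs <;> simp
  obtain ⟨e, he, heE⟩ := exists_isIdempotentElem_eq_of_ker_isNilpotent q.toRingHom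
    (fun x hx => hnil x hx) E (hq E) hE
  refine ⟨e, he, fun θ hθ hθnil => ?_⟩
  obtain ⟨σ, hσ⟩ := LinearMap.exists_rightInverse_of_surjective q.toLinearMap
    (LinearMap.range_eq_top.mpr hq)
  have hσ' (x) : q (σ x) = x := congr($hσ x)
  have hθq (x y : B) (h : q x = q y) : θ x = θ y := by
    rw [← sub_eq_zero, ← map_sub]
    exact hθnil _ (hnil _ (by rw [map_sub, h, sub_self]))
  have hθσ (x : B) : θ (σ (q x)) = θ x := hθq _ _ (hσ' _)
  rw [← hθσ g, ← hθσ (2 * e - 1)]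
  refine Matrix.traceForm_pi_eq (θ ∘ₗ σ) (fun x y => ?_) fun i => ?_
  · simp only [coe_comp, Function.comp_apply]
    rw [hθq (σ (x * y)) (σ x * σ y) (by simp [hσ']), hθ,
      hθq (σ (y * x)) (σ y * σ x) (by simp [hσ'])]
  · have : q e = E := heE
    simp only [map_sub, map_mul, this, map_ofNat, map_one, Pi.sub_apply, Pi.mul_apply,
      Pi.ofNat_apply, E]
    split_ifs with h
    · rw [h, mul_one, show (2 - 1 : Matrix (Fin (d i)) (Fin (d i)) K) = 1 by norm_num]
      simp
    · rw [(hsign i).resolve_left h]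
      simp

lemma trace_mulLeft_comp_mulRight_eq {g g' s : B}
    (hg : ∀ θ : B →ₗ[K] K, (∀ x y, θ (x * y) = θ (y * x)) →
      (∀ x, IsNilpotent x → θ x = 0) → θ g = θ s)
    (hg' : ∀ θ : B →ₗ[K] K, (∀ x y, θ (x * y) = θ (y * x)) →
      (∀ x, IsNilpotent x → θ x = 0) → θ g' = θ s) :
    LinearMap.trace K B (mulLeft K g ∘ₗ mulRight K g') =
      LinearMap.trace K B (mulLeft K s ∘ₗ mulRight K s) := by
  have hc (a b : B) : Commute (mulLeft K a) (mulRight K b) := commute_mulLeft_right a b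
  trans LinearMap.trace K B (mulLeft K s ∘ₗ mulRight K g')
  · refine hg (LinearMap.trace K B ∘ₗ (LinearMap.mul K (Module.End K B)).flip (mulRight K g') ∘ₗ
      LinearMap.mul K B) (fun x y => ?_) fun x hx => ?_
    · change LinearMap.trace K B (mulLeft K (x * y) * mulRight K g') =
        LinearMap.trace K B (mulLeft K (y * x) * mulRight K g')
      rw [mulLeft_mul, mulLeft_mul, ← Module.End.mul_eq_comp, ← Module.End.mul_eq_comp, mul_assoc,
        LinearMap.trace_mul_comm, mul_assoc, mul_assoc, (hc x g').eq]
    · change LinearMap.trace K B (mulLeft K x * mulRight K g') = 0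
      have : IsNilpotent (mulLeft K x) := by
        obtain ⟨N, hN⟩ := hx
        exact ⟨N, by rw [pow_mulLeft, hN, mulLeft_zero_eq_zero]⟩
      exact (LinearMap.isNilpotent_trace_of_isNilpotent
        ((hc x g').isNilpotent_mul_right this)).eq_zero
  · refine hg' (LinearMap.trace K B ∘ₗ LinearMap.mul K (Module.End K B) (mulLeft K s) ∘ₗ
      (LinearMap.mul K B).flip) (fun x y => ?_) fun x hx => ?_
    · change LinearMap.trace K B (mulLeft K s * mulRight K (x * y)) =
        LinearMap.trace K B (mulLeft K s * mulRight K (y * x))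
      rw [mulRight_mul, mulRight_mul, ← Module.End.mul_eq_comp, ← Module.End.mul_eq_comp,
        ← mul_assoc, LinearMap.trace_mul_comm, ← mul_assoc, ← (hc s x).eq, mul_assoc]
    · change LinearMap.trace K B (mulLeft K s * mulRight K x) = 0
      have : IsNilpotent (mulRight K x) := by
        obtain ⟨N, hN⟩ := hx
        exact ⟨N, by rw [pow_mulRight, hN, mulRight_zero_eq_zero]⟩
      exact (LinearMap.isNilpotent_trace_of_isNilpotent
        ((hc s x).isNilpotent_mul_left this)).eq_zero

lemma commute_of_trace_mulLeft_comp_mulRight [CharZero K] [FiniteDimensional K B] {s : B}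
    (hs : s * s = 1)
    (h : LinearMap.trace K B (mulLeft K s ∘ₗ mulRight K s) = Module.finrank K B) (b : B) :
    Commute s b := by
  let σ : Module.End K B := mulLeft K s ∘ₗ mulRight K s
  have hσ : σ * σ = 1 := by
    ext b
    simp only [σ, Module.End.mul_apply, coe_comp, Function.comp_apply, mulLeft_apply,
      mulRight_apply, Module.End.one_apply]
    rw [show s * (s * (b * s) * s) = s * s * b * (s * s) by noncomm_ring, hs, one_mul, mul_one]
  have hidem : IsIdempotentElem ((2⁻¹ : K) • (1 - σ)) := by
    rw [IsIdempotentElem, smul_mul_smul_comm,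
      show (1 - σ) * (1 - σ) = 1 - σ - σ + σ * σ by
        rw [sub_mul, mul_sub, one_mul, mul_sub, one_mul, mul_one]; abel,
      hσ,
      show 1 - σ - σ + 1 = (2 : K) • (1 - σ) by rw [two_smul]; abel, smul_smul]
    norm_num
  have h0 := hidem.eq_zero_of_trace_eq_zero (by simp [σ, h, LinearMap.trace_one])
  have h1 : (1 - σ) b = 0 := by
    have : 1 - σ = 0 := (smul_eq_zero.mp h0).resolve_left (by norm_num)
    rw [this, LinearMap.zero_apply]
  have h2 : b = s * (b * s) := by simpa [σ, sub_eq_zero] using h1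
  rw [Commute, SemiconjBy]
  nth_rw 1 [h2]
  rw [← mul_assoc, hs, one_mul]

end TraceForms

section Separation

variable {K M N : Type*} [Field K] [AddCommGroup M] [Module K M] [AddCommGroup N] [Module K N]

lemma TensorProduct.ext_of_dual_pair {x y : M ⊗[K] N}
    (h : ∀ (f : M →ₗ[K] K) (g : N →ₗ[K] K), mul' K K (map f g x) = mul' K K (map f g y)) :
    x = y := by
  let b := Module.Basis.ofVectorSpace K M
  let c := Module.Basis.ofVectorSpace K N
  refine (b.tensorProduct c).ext_elem fun ⟨i, j⟩ => ?_
  have (z : M ⊗[K] N) :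
      (b.tensorProduct c).repr z (i, j) = mul' K K (map (b.coord i) (c.coord j) z) := by
    induction z with
    | zero => simp
    | tmul v w => simp [Module.Basis.tensorProduct_repr_tmul_apply, mul_comm]
    | add v w hv hw => simp only [map_add, Finsupp.add_apply, hv, hw]
  rw [this, this, h]

lemma TensorProduct.ext_of_dual_right {x y : M ⊗[K] N}
    (h : ∀ g : N →ₗ[K] K, TensorProduct.rid K M (map LinearMap.id g x) =
      TensorProduct.rid K M (map LinearMap.id g y)) : x = y := by
  refine ext_of_dual_pair fun f g => ?_
  have (z : M ⊗[K] N) :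
      mul' K K (map f g z) = f (TensorProduct.rid K M (map LinearMap.id g z)) := by
    induction z with
    | zero => simp
    | tmul v w => simp [mul_comm]
    | add v w hv hw => simp only [map_add, hv, hw]
  rw [this, this, h]

lemma TensorProduct.mul'_map_comm (f : M →ₗ[K] K) (g : N →ₗ[K] K) (z : N ⊗[K] M) :
    mul' K K (map f g (TensorProduct.comm K N M z)) = mul' K K (map g f z) := by
  induction z with
  | zero => simp
  | tmul v w => simp [mul_comm]
  | add v w hv hw => simp only [map_add, hv, hw]

end Separation

section DualAlgebra

variable {D : Type*} [Ring D] [Algebra k D]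
  {π : (A →ₗ[k] k) →ₗ[k] D} {T : Module.Dual k D →ₗ[k] A}

lemma comul_transpose [FiniteDimensional k D]
    (hT : ∀ (ξ : Module.Dual k D) (f : A →ₗ[k] k), f (T ξ) = ξ (π f))
    (hmul : ∀ f g, π (conv1 f g) = π f * π g) (ξ : Module.Dual k D) :
    Coalgebra.comul (R := k) (T ξ) =
      ∑ i, ∑ j, ξ (Module.finBasis k D i * Module.finBasis k D j) •
        (T ((Module.finBasis k D).coord i) ⊗ₜ[k] T ((Module.finBasis k D).coord j)) := by
  refine ext_of_dual_pair fun f g => ?_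
  set b := Module.finBasis k D
  change conv1 f g (T ξ) = _
  rw [hT, hmul]
  nth_rw 1 [← b.sum_repr (π f), ← b.sum_repr (π g)]
  simp only [Finset.sum_mul_sum, map_sum, map_smul, map_tmul, mul'_apply, hT, smul_mul_smul_comm,
    Module.Basis.coord_apply, smul_eq_mul]
  exact Finset.sum_congr rfl fun i _ => Finset.sum_congr rfl fun j _ => mul_comm _ _

lemma traceForm_drinfeld_eq (R : A ⊗[k] A →ₗ[k] k)
    (hT : ∀ (ξ : Module.Dual k D) (f : A →ₗ[k] k), f (T ξ) = ξ (π f))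
    (hmul : ∀ f g, π (conv1 f g) = π f * π g)
    (θ : D →ₗ[k] k) (hθ : ∀ x y, θ (x * y) = θ (y * x)) :
    θ (π (drinfeld R)) = θ (π (drinfeldInv R)) := by
  have hcomm : TensorProduct.comm k A A (Coalgebra.comul (T θ)) = Coalgebra.comul (T θ) := by
    refine ext_of_dual_pair fun f g => ?_
    rw [mul'_map_comm]
    change conv1 g f (T θ) = conv1 f g (T θ)
    rw [hT, hT, hmul, hmul, hθ]
  rw [← hT, ← hT, drinfeld, drinfeldInv]
  simp only [coe_comp, Function.comp_apply, LinearEquiv.coe_coe, hcomm]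

lemma trace_conj_drinfeld [FiniteDimensional k D] (hpi : Pseudoinvolutive k A) {a a' : D}
    (hT : ∀ (ξ : Module.Dual k D) (f : A →ₗ[k] k), f (T ξ) = ξ (π f))
    (hmul : ∀ f g, π (conv1 f g) = π f * π g) (hπ : Function.Surjective π)
    (hS : ∀ f : A →ₗ[k] k,
      π (f ∘ₗ HopfAlgebra.antipode k ∘ₗ HopfAlgebra.antipode k) = a * π f * a') :
    trace k D (mulLeft k a ∘ₗ mulRight k a') = Module.finrank k D := by
  have hinj : Function.Injective T := by
    refine (injective_iff_map_eq_zero T).mpr fun ξ hξ => LinearMap.ext fun x => ?_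
    obtain ⟨f, rfl⟩ := hπ x
    rw [← hT, hξ, map_zero, LinearMap.zero_apply]
  have hST (ξ : Module.Dual k D) : (HopfAlgebra.antipode k ∘ₗ HopfAlgebra.antipode k) (T ξ) =
      T (Module.Dual.transpose (mulLeft k a ∘ₗ mulRight k a') ξ) := by
    refine (Module.forall_dual_apply_eq_zero_iff k _).mp (fun f => ?_) |> sub_eq_zero.mp
    rw [map_sub, sub_eq_zero, hT]
    change (f ∘ₗ HopfAlgebra.antipode k ∘ₗ HopfAlgebra.antipode k) (T ξ) = _
    rw [hT, hS]
    simp [Module.Dual.transpose_apply, mul_assoc]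
  let e := LinearEquiv.ofInjective T hinj
  have hmaps : ∀ x ∈ range T, (HopfAlgebra.antipode k ∘ₗ HopfAlgebra.antipode k) x ∈ range T := by
    rintro _ ⟨ξ, rfl⟩
    exact ⟨_, (hST ξ).symm⟩
  have h := hpi (range T) inferInstance (by
    rintro _ ⟨ξ, rfl⟩
    rw [comul_transpose hT hmul]
    exact Submodule.sum_mem _ fun i _ => Submodule.sum_mem _ fun j _ =>
      Submodule.smul_mem _ _ ⟨⟨_, mem_range_self _ _⟩ ⊗ₜ ⟨_, mem_range_self _ _⟩, rfl⟩) hmaps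
  have hconj : (HopfAlgebra.antipode k ∘ₗ HopfAlgebra.antipode k).restrict hmaps =
      e.conj (Module.Dual.transpose (mulLeft k a ∘ₗ mulRight k a')) := by
    ext x
    obtain ⟨ξ, rfl⟩ := e.surjective x
    rw [LinearEquiv.conj_apply_apply, LinearEquiv.symm_apply_apply]
    exact hST ξ
  rw [hconj, trace_conj', trace_transpose', ← e.finrank_eq, Subspace.dual_finrank_eq] at h
  exact h

end DualAlgebra

section Comodule

variable {V : Type u} [AddCommGroup V] [Module k V] {ρ : V →ₗ[k] V ⊗[k] A}

lemma IsComod.coact_conv1 (hρ : IsComod V ρ) (f g : A →ₗ[k] k) :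
    coact ρ (conv1 f g) = coact ρ f * coact ρ g := by
  have h1 (w : V ⊗[k] A) (a : A) :
      TensorProduct.rid k V (map LinearMap.id (mul' k k ∘ₗ map f g)
        (TensorProduct.assoc k V A A (w ⊗ₜ a))) =
      g a • TensorProduct.rid k V (map LinearMap.id f w) := by
    induction w with
    | zero => simp
    | tmul v b => simp [smul_smul, mul_comm]
    | add v w hv hw => simp only [add_tmul, map_add, hv, hw, smul_add]
  have h2 (z : V ⊗[k] A) :
      TensorProduct.rid k V (map LinearMap.id (mul' k k ∘ₗ map f g)
        (TensorProduct.assoc k V A A (map ρ LinearMap.id z))) =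
      coact ρ f (TensorProduct.rid k V (map LinearMap.id g z)) := by
    induction z with
    | zero => simp
    | tmul v b => rw [map_tmul, LinearMap.id_apply, h1]; simp [coact]
    | add v w hv hw => simp only [map_add, hv, hw]
  ext v
  have h := congr($(hρ.coassoc) v)
  simp only [coe_comp, Function.comp_apply, LinearEquiv.coe_coe] at h
  rw [Module.End.mul_apply]
  conv_rhs => rw [coact.eq_def (f := g)]
  simp only [coe_comp, Function.comp_apply, LinearEquiv.coe_coe]
  rw [← h2, h, ← comp_apply, ← map_comp, LinearMap.id_comp, comp_assoc]
  rfl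

lemma IsComod.coact_counit (hρ : IsComod V ρ) : coact ρ Coalgebra.counit = 1 := hρ.counit_id

lemma coact_comp_of_isComodMap {W : Type u} [AddCommGroup W] [Module k W] {ρW : W →ₗ[k] W ⊗[k] A}
    {φ : V →ₗ[k] W} (hφ : IsComodMap ρ ρW φ) (f : A →ₗ[k] k) :
    coact ρW f ∘ₗ φ = φ ∘ₗ coact ρ f := by
  have h (z : V ⊗[k] A) : TensorProduct.rid k W (map LinearMap.id f (map φ LinearMap.id z)) =
      φ (TensorProduct.rid k V (map LinearMap.id f z)) := by
    induction z with
    | zero => simp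
    | tmul v b => simp
    | add v w hv hw => simp only [map_add, hv, hw]
  ext v
  have := congr($hφ v)
  simp only [coe_comp, Function.comp_apply] at this
  simp only [coact, coe_comp, Function.comp_apply, LinearEquiv.coe_coe, this, h]

lemma isComodMap_of_coact_comp {W : Type u} [AddCommGroup W] [Module k W] {ρW : W →ₗ[k] W ⊗[k] A}
    {φ : V →ₗ[k] W} (h : ∀ f : A →ₗ[k] k, coact ρW f ∘ₗ φ = φ ∘ₗ coact ρ f) :
    IsComodMap ρ ρW φ := by
  have h1 (f : A →ₗ[k] k) (z : V ⊗[k] A) :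
      TensorProduct.rid k W (map LinearMap.id f (map φ LinearMap.id z)) =
      φ (TensorProduct.rid k V (map LinearMap.id f z)) := by
    induction z with
    | zero => simp
    | tmul v b => simp
    | add v w hv hw => simp only [map_add, hv, hw]
  ext1 v
  refine ext_of_dual_right fun f => ?_
  have := congr($(h f) v)
  simp only [coact, coe_comp, Function.comp_apply, LinearEquiv.coe_coe] at this
  simp only [coe_comp, Function.comp_apply, h1, this]

/-- The matrix coefficients of a comodule with respect to a basis. -/
def coeffMatrix {n : Type*} (ρ : V →ₗ[k] V ⊗[k] A) (b : Module.Basis n k V) : Matrix n n A :=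
  .of fun i j => TensorProduct.lid k A (map (b.coord i) LinearMap.id (ρ (b j)))

lemma coact_apply_basis {n : Type*} [Fintype n] [DecidableEq n] (b : Module.Basis n k V)
    (f : A →ₗ[k] k) : LinearMap.toMatrix b b (coact ρ f) = (coeffMatrix ρ b).map f := by
  ext i j
  have h (z : V ⊗[k] A) : b.repr (TensorProduct.rid k V (map LinearMap.id f z)) i =
      f (TensorProduct.lid k A (map (b.coord i) LinearMap.id z)) := by
    induction z with
    | zero => simp
    | tmul v b => simp [mul_comm]
    | add v w hv hw => simp only [map_add, Finsupp.add_apply, hv, hw]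
  simp [LinearMap.toMatrix_apply, coact, coeffMatrix, h]

lemma IsComod.isMultiplicativeMatrix {n : Type*} [Fintype n] [DecidableEq n] (hρ : IsComod V ρ)
    (b : Module.Basis n k V) : IsMultiplicativeMatrix (k := k) (coeffMatrix ρ b) where
  comul_apply i j := by
    refine ext_of_dual_pair fun f g => ?_
    change (coeffMatrix ρ b).map (conv1 f g) i j = _
    rw [← coact_apply_basis, hρ.coact_conv1, LinearMap.toMatrix_mul, coact_apply_basis,
      coact_apply_basis, Matrix.mul_apply]
    simp
  counit_apply i j := by
    change (coeffMatrix ρ b).map (Coalgebra.counit (R := k)) i j = _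
    rw [← coact_apply_basis, hρ.coact_counit, LinearMap.toMatrix_one]

end Comodule

section CentralIdempotent

variable [IsAlgClosed k] [CharZero k] {R : A ⊗[k] A →ₗ[k] k}

/-- On a finite-dimensional quotient `D` of the dual algebra `A*`, the image of the Drinfeld
element has the same semisimple part as `2e - 1` for a central idempotent `e`. -/
lemma exists_central_idempotent {D : Type*} [Ring D] [Algebra k D] [FiniteDimensional k D]
    {π : (A →ₗ[k] k) →ₗ[k] D} {T : Module.Dual k D →ₗ[k] A} (hpi : Pseudoinvolutive k A)
    (hT : ∀ (ξ : Module.Dual k D) (f : A →ₗ[k] k), f (T ξ) = ξ (π f))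
    (hmul : ∀ f g, π (conv1 f g) = π f * π g) (hπ : Function.Surjective π)
    (hS : ∀ f : A →ₗ[k] k, π (f ∘ₗ HopfAlgebra.antipode k ∘ₗ HopfAlgebra.antipode k) =
      π (drinfeld R) * π f * π (drinfeldInv R)) :
    ∃ e : D, IsIdempotentElem e ∧ (∀ b, Commute e b) ∧ ∀ θ : D →ₗ[k] k,
      (∀ x y, θ (x * y) = θ (y * x)) → (∀ x, IsNilpotent x → θ x = 0) →
        θ (π (drinfeld R)) = θ (2 * e - 1) := by
  have hinv (θ : D →ₗ[k] k) (hθ : ∀ x y, θ (x * y) = θ (y * x)) :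
      θ (π (drinfeld R)) = θ (π (drinfeldInv R)) :=
    traceForm_drinfeld_eq R hT hmul θ hθ
  have hsimple (d : ℕ) (φ : D →ₐ[k] Matrix (Fin d) (Fin d) k) (hφ : Function.Surjective φ) :
      (φ (π (drinfeld R))).trace * (φ (π (drinfeldInv R))).trace = d * d := by
    have h := trace_conj_drinfeld (π := φ.toLinearMap ∘ₗ π)
      (T := T ∘ₗ Module.Dual.transpose φ.toLinearMap) hpi
      (a := φ (π (drinfeld R))) (a' := φ (π (drinfeldInv R)))
      (fun ξ f => by simp [hT, Module.Dual.transpose_apply]) (fun f g => by simp [hmul])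
      (hφ.comp hπ) (fun f => by simp [hS])
    rwa [Matrix.trace_mulLeft_comp_mulRight, Module.finrank_matrix, Module.finrank_self,
      Fintype.card_fin, mul_one, Nat.cast_mul] at h
  obtain ⟨e, he, hθ⟩ := exists_isIdempotentElem_traceForm_eq _ _ hsimple hinv
  refine ⟨e, he, fun b => ?_, hθ⟩
  have hs : (2 * e - 1) * (2 * e - 1) = 1 := by
    simp only [sub_mul, mul_sub, two_mul, add_mul, mul_add, he.eq, one_mul, mul_one]
    abel
  have htr := trace_conj_drinfeld hpi hT hmul hπ hS
  rw [trace_mulLeft_comp_mulRight_eq hθ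
    (fun θ h1 h2 => (hinv θ h1).symm.trans (hθ θ h1 h2))] at htr
  have hc := commute_of_trace_mulLeft_comp_mulRight hs htr b
  have h2 : (2 : k) • (e * b) = (2 : k) • (b * e) := by
    have := hc.eq
    simp only [sub_mul, mul_sub, one_mul, mul_one, sub_left_inj, two_mul, add_mul,
      mul_add] at this
    rw [two_smul, two_smul, this]
  exact smul_right_injective D (two_ne_zero' k) h2

lemma IsMultiplicativeMatrix.exists_central_idempotent {n : Type*} [Fintype n] [DecidableEq n]
    {t : Matrix n n A} (ht : IsMultiplicativeMatrix (k := k) t) (hR : IsCT (mul' k A) R)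
    (hpi : Pseudoinvolutive k A) :
    ∃ f₀ : A →ₗ[k] k, IsIdempotentElem (t.map f₀) ∧ (∀ f : A →ₗ[k] k,
      Commute (t.map f₀) (t.map f)) ∧ ∀ Θ : Matrix n n k →ₗ[k] k,
      (∀ f g : A →ₗ[k] k, Θ (t.map f * t.map g) = Θ (t.map g * t.map f)) →
      (∀ f : A →ₗ[k] k, IsNilpotent (t.map f) → Θ (t.map f) = 0) →
        Θ (t.map (drinfeld R)) = Θ (2 * t.map f₀ - 1) := by
  let π₀ : (A →ₗ[k] k) →ₗ[k] Matrix n n k :=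
    { toFun f := t.map f
      map_add' f g := by ext; simp
      map_smul' c f := by ext; simp }
  have hmul₀ (f g : A →ₗ[k] k) : π₀ (conv1 f g) = π₀ f * π₀ g := by
    ext i j
    simp [π₀, conv1, ht.comul_apply, Matrix.mul_apply]
  have hone₀ : π₀ Coalgebra.counit = 1 := by
    ext i j
    simp [π₀, ht.counit_apply]
  let B : Subalgebra k (Matrix n n k) := (range π₀).toSubalgebra ⟨_, hone₀⟩ (by
    rintro _ _ ⟨f, rfl⟩ ⟨g, rfl⟩
    exact ⟨_, hmul₀ f g⟩)
  let π : (A →ₗ[k] k) →ₗ[k] B := π₀.codRestrict (Subalgebra.toSubmodule B) fun f => ⟨f, rfl⟩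
  have hπ : Function.Surjective π := by
    rintro ⟨_, f, rfl⟩
    exact ⟨f, rfl⟩
  obtain ⟨q, hq⟩ := B.val.toLinearMap.exists_leftInverse_of_injective
    (ker_eq_bot.mpr Subtype.val_injective)
  let T : Module.Dual k B →ₗ[k] A :=
    { toFun ξ := ∑ i, ∑ j, ξ (q (Matrix.single i j 1)) • t i j
      map_add' ξ η := by simp [add_smul, Finset.sum_add_distrib]
      map_smul' c ξ := by simp [mul_smul, Finset.smul_sum] }
  have hT (ξ : Module.Dual k B) (f : A →ₗ[k] k) : f (T ξ) = ξ (π f) := by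
    have h : π f = q (t.map f) := congr($hq (π f)).symm
    rw [h, Matrix.matrix_eq_sum_single (t.map f)]
    simp only [T, LinearMap.coe_mk, AddHom.coe_mk, map_sum, map_smul, smul_eq_mul]
    refine Finset.sum_congr rfl fun i _ => Finset.sum_congr rfl fun j _ => ?_
    rw [← mul_one (t.map f i j), ← smul_eq_mul (t.map f i j), ← Matrix.smul_single, map_smul,
      map_smul, smul_eq_mul, mul_comm, Matrix.map_apply]
  have hmul (f g : A →ₗ[k] k) : π (conv1 f g) = π f * π g := Subtype.ext (hmul₀ f g)
  have hinv₀ : π₀ (drinfeld R) * π₀ (drinfeldInv R) = 1 := by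
    ext i j
    simpa [π₀, Matrix.mul_apply] using ht.sum_drinfeld_mul_drinfeldInv hR i j
  have hS (f : A →ₗ[k] k) : π (f ∘ₗ HopfAlgebra.antipode k ∘ₗ HopfAlgebra.antipode k) =
      π (drinfeld R) * π f * π (drinfeldInv R) := by
    refine Subtype.ext ?_
    change π₀ _ = π₀ _ * π₀ _ * π₀ _
    have h : π₀ (drinfeld R) * π₀ f =
        π₀ (f ∘ₗ HopfAlgebra.antipode k ∘ₗ HopfAlgebra.antipode k) * π₀ (drinfeld R) := by
      ext i j
      have := congr(f $(ht.sum_drinfeld_smul hR i j))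
      simpa [π₀, Matrix.mul_apply, mul_comm] using this
    rw [h, mul_assoc, hinv₀, mul_one]
  obtain ⟨e, he, hc, hθ⟩ := _root_.exists_central_idempotent hpi hT hmul hπ hS
  obtain ⟨f₀, rfl⟩ := hπ e
  refine ⟨f₀, congr_arg Subtype.val he.eq, fun f => congr_arg Subtype.val (hc (π f)).eq,
    fun Θ h1 h2 => hθ (Θ ∘ₗ B.val.toLinearMap) ?_ ?_⟩
  · rintro ⟨_, f, rfl⟩ ⟨_, g, rfl⟩
    exact h1 f g
  · rintro ⟨_, f, rfl⟩ ⟨m, hm⟩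
    exact h2 f ⟨m, congr_arg Subtype.val hm⟩

end CentralIdempotent

section Splitting

variable {R : A ⊗[k] A →ₗ[k] k}
  {U V W : Type u} [AddCommGroup U] [Module k U]
  [AddCommGroup V] [Module k V]
  [AddCommGroup W] [Module k W]
  {ρU : U →ₗ[k] U ⊗[k] A} {ρV : V →ₗ[k] V ⊗[k] A} {ρW : W →ₗ[k] W ⊗[k] A}

lemma IsComod.exists_central_idempotent [IsAlgClosed k] [CharZero k]
    [FiniteDimensional k U] (hU : IsComod U ρU)
    (hR : IsCT (mul' k A) R) (hpi : Pseudoinvolutive k A) :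
    ∃ f₀ : A →ₗ[k] k, IsIdempotentElem (coact ρU f₀) ∧ (∀ f : A →ₗ[k] k,
      Commute (coact ρU f₀) (coact ρU f)) ∧ ∀ Θ : Module.End k U →ₗ[k] k,
      (∀ f g : A →ₗ[k] k, Θ (coact ρU f * coact ρU g) = Θ (coact ρU g * coact ρU f)) →
      (∀ f : A →ₗ[k] k, IsNilpotent (coact ρU f) → Θ (coact ρU f) = 0) →
        Θ (coact ρU (drinfeld R)) = Θ (2 * coact ρU f₀ - 1) := by
  let b := Module.finBasis k U
  let φ := LinearMap.toMatrixAlgEquiv b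
  have hφ (f : A →ₗ[k] k) : φ.symm ((coeffMatrix ρU b).map f) = coact ρU f := by
    rw [AlgEquiv.symm_apply_eq]
    exact (coact_apply_basis b f).symm
  obtain ⟨f₀, he, hc, hθ⟩ := (hU.isMultiplicativeMatrix b).exists_central_idempotent hR hpi
  refine ⟨f₀, ?_, fun f => ?_, fun Θ h1 h2 => ?_⟩
  · simpa [hφ] using he.map φ.symm
  · simpa [hφ] using (hc f).map φ.symm
  · have h := hθ (Θ ∘ₗ φ.symm.toLinearMap) (fun f g => by simpa [hφ] using h1 f g)
      (fun f hf => by simpa [hφ] using h2 f (by simpa [hφ] using hf.map φ.symm))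
    simpa [hφ, two_mul] using h

lemma IsComod.exists_coact_eq_pow (hU : IsComod U ρU) (hV : IsComod V ρV) (f : A →ₗ[k] k)
    (m : ℕ) : ∃ g : A →ₗ[k] k, coact ρU g = coact ρU f ^ m ∧ coact ρV g = coact ρV f ^ m := by
  induction m with
  | zero => exact ⟨_, hU.coact_counit, hV.coact_counit⟩
  | succ m ih =>
    obtain ⟨g, h1, h2⟩ := ih
    exact ⟨conv1 g f, by rw [hU.coact_conv1, h1, pow_succ], by rw [hV.coact_conv1, h2, pow_succ]⟩

lemma IsComod.isIdempotentElem_coact (hU : IsComod U ρU) (hV : IsComod V ρV)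
    {Λ : Module.End k U →ₗ[k] Module.End k V}
    (hΛ : ∀ f : A →ₗ[k] k, Λ (coact ρU f) = coact ρV f) {f₀ : A →ₗ[k] k}
    (he : IsIdempotentElem (coact ρU f₀)) : IsIdempotentElem (coact ρV f₀) := by
  rw [IsIdempotentElem, ← hV.coact_conv1, ← hΛ, hU.coact_conv1, he.eq, hΛ]

lemma IsComod.trace_coact_drinfeld [FiniteDimensional k V] (hU : IsComod U ρU)
    (hV : IsComod V ρV) {Λ : Module.End k U →ₗ[k] Module.End k V}
    (hΛ : ∀ f : A →ₗ[k] k, Λ (coact ρU f) = coact ρV f) {f₀ : A →ₗ[k] k}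
    (hθ : ∀ Θ : Module.End k U →ₗ[k] k,
      (∀ f g : A →ₗ[k] k, Θ (coact ρU f * coact ρU g) = Θ (coact ρU g * coact ρU f)) →
      (∀ f : A →ₗ[k] k, IsNilpotent (coact ρU f) → Θ (coact ρU f) = 0) →
        Θ (coact ρU (drinfeld R)) = Θ (2 * coact ρU f₀ - 1)) :
    trace k V (coact ρV (drinfeld R)) =
      2 * trace k V (coact ρV f₀) - (Module.finrank k V : k) := by
  have h := hθ (trace k V ∘ₗ Λ) (fun f g => ?_) (fun f hf => ?_)
  · rw [two_mul, ← hU.coact_counit, map_sub, map_add] at h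
    simpa only [coe_comp, Function.comp_apply, hΛ, hV.coact_counit, trace_one, ← two_mul] using h
  · rw [← hU.coact_conv1, ← hU.coact_conv1, comp_apply, comp_apply, hΛ, hΛ, hV.coact_conv1,
      hV.coact_conv1, trace_mul_comm]
  · obtain ⟨m, hm⟩ := hf
    obtain ⟨g, h1, h2⟩ := hU.exists_coact_eq_pow hV f m
    rw [comp_apply, hΛ]
    have hnil : IsNilpotent (coact ρV f) := ⟨m, by rw [← h2, ← hΛ, h1, hm, map_zero]⟩
    exact (isNilpotent_trace_of_isNilpotent hnil).eq_zero

lemma LinearMap.IsIdempotentElem.eq_one_of_trace_eq_finrank [CharZero k]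
    [FiniteDimensional k V]
    {E : Module.End k V} (hE : IsIdempotentElem E)
    (h : trace k V E = (Module.finrank k V : k)) : E = 1 := by
  have := LinearMap.IsIdempotentElem.eq_zero_of_trace_eq_zero hE.one_sub (by
    rw [map_sub, trace_one, h, sub_self])
  exact (sub_eq_zero.mp this).symm

/-- A morphism of a comodule extension to itself that kills the subobject and induces the
identity on the quotient yields a splitting. -/
lemma exists_section_of_commute {i : V →ₗ[k] U} {p : U →ₗ[k] W} (hp : IsComodMap ρU ρW p)
    (hsurj : Function.Surjective p) (hexact : range i = ker p) {P : Module.End k U}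
    (hP : ∀ f : A →ₗ[k] k, Commute P (coact ρU f)) (hPi : P ∘ₗ i = 0) (hpP : p ∘ₗ P = p) :
    ∃ s : W →ₗ[k] U, IsComodMap ρW ρU s ∧ p ∘ₗ s = LinearMap.id := by
  obtain ⟨r, hr⟩ := p.exists_rightInverse_of_surjective (range_eq_top.mpr hsurj)
  refine ⟨P ∘ₗ r, isComodMap_of_coact_comp fun f => ?_, by rw [← comp_assoc, hpP, hr]⟩
  ext w
  have hmem : coact ρU f (r w) - r (coact ρW f w) ∈ ker p := by
    have h1 := congr($(coact_comp_of_isComodMap hp f) (r w))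
    have h2 := congr($hr w)
    have h3 := congr($hr (coact ρW f w))
    simp only [comp_apply, LinearMap.id_apply] at h1 h2 h3
    rw [mem_ker, map_sub, ← h1, h2, h3, sub_self]
  rw [← hexact] at hmem
  obtain ⟨v, hv⟩ := hmem
  have h4 := congr($hPi v)
  have h5 := congr($((hP f).eq) (r w))
  simp only [comp_apply, hv, LinearMap.zero_apply, map_sub, sub_eq_zero,
    Module.End.mul_apply] at h4 h5
  simp only [comp_apply, ← h4, h5]

end Splitting

section

/-- For a pseudoinvolutive cotriangular Hopf algebra `(A, R)` with Drinfeld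
element `u`, if `V` is a positive and `W` a negative finite-dimensional right `A`-comodule
(or vice versa), then every short exact sequence `0 → V → U → W → 0` of comodules splits. -/
theorem statement2 {k A : Type u} [Field k] [IsAlgClosed k] [CharZero k]
    [Ring A] [HopfAlgebra k A]
    (R : A ⊗[k] A →ₗ[k] k) (hR : IsCT (mul' k A) R)
    (hpi : Pseudoinvolutive k A)
    (V U W : Type u)
    [AddCommGroup V] [Module k V] [FiniteDimensional k V]
    [AddCommGroup U] [Module k U] [FiniteDimensional k U]
    [AddCommGroup W] [Module k W] [FiniteDimensional k W]
    (ρV : V →ₗ[k] V ⊗[k] A) (ρU : U →ₗ[k] U ⊗[k] A) (ρW : W →ₗ[k] W ⊗[k] A)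
    (hV : IsComod V ρV) (hU : IsComod U ρU) (hW : IsComod W ρW)
    (hsign :
      (trace k V (coact ρV (drinfeld R)) = (Module.finrank k V : k) ∧
        trace k W (coact ρW (drinfeld R)) = -(Module.finrank k W : k)) ∨
      (trace k V (coact ρV (drinfeld R)) = -(Module.finrank k V : k) ∧
        trace k W (coact ρW (drinfeld R)) = (Module.finrank k W : k)))
    (i : V →ₗ[k] U) (p : U →ₗ[k] W)
    (hi : IsComodMap ρV ρU i) (hp : IsComodMap ρU ρW p)
    (hinj : Function.Injective i) (hsurj : Function.Surjective p)
    (hexact : LinearMap.range i = LinearMap.ker p) :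
    ∃ s : W →ₗ[k] U, IsComodMap ρW ρU s ∧ p ∘ₗ s = LinearMap.id := by
  obtain ⟨f₀, he, hc, hθ⟩ := hU.exists_central_idempotent hR hpi
  obtain ⟨j, hj⟩ := i.exists_leftInverse_of_injective (ker_eq_bot.mpr hinj)
  obtain ⟨r, hr⟩ := p.exists_rightInverse_of_surjective (range_eq_top.mpr hsurj)
  have hcoi := coact_comp_of_isComodMap hi
  have hcop := coact_comp_of_isComodMap hp
  let Λ : Module.End k U →ₗ[k] Module.End k V := llcomp k V U V j ∘ₗ lcomp k U i
  let Λ' : Module.End k U →ₗ[k] Module.End k W := lcomp k W r ∘ₗ llcomp k U U W p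
  have hΛ (f : A →ₗ[k] k) : Λ (coact ρU f) = coact ρV f := by
    change j ∘ₗ (coact ρU f ∘ₗ i) = _
    rw [hcoi, ← comp_assoc, hj, LinearMap.id_comp]
  have hΛ' (f : A →ₗ[k] k) : Λ' (coact ρU f) = coact ρW f := by
    change (p ∘ₗ coact ρU f) ∘ₗ r = _
    rw [← hcop, comp_assoc, hr, LinearMap.comp_id]
  have hVtr := hU.trace_coact_drinfeld hV hΛ hθ
  have hWtr := hU.trace_coact_drinfeld hW hΛ' hθ
  have hVe := hU.isIdempotentElem_coact hV hΛ he
  have hWe := hU.isIdempotentElem_coact hW hΛ' he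
  rcases hsign with ⟨h1, h2⟩ | ⟨h1, h2⟩
  · have hV1 : coact ρV f₀ = 1 :=
      hVe.eq_one_of_trace_eq_finrank (by linear_combination (h1 - hVtr) / 2)
    have hW0 : coact ρW f₀ = 0 :=
      LinearMap.IsIdempotentElem.eq_zero_of_trace_eq_zero hWe
        (by linear_combination (h2 - hWtr) / 2)
    refine exists_section_of_commute hp hsurj hexact (P := 1 - coact ρU f₀)
      (fun f => (Commute.one_left _).sub_left (hc f)) ?_ ?_
    · rw [sub_comp, hcoi, hV1, Module.End.one_eq_id, Module.End.one_eq_id, LinearMap.id_comp,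
        LinearMap.comp_id, sub_self]
    · rw [comp_sub, ← hcop, hW0, Module.End.one_eq_id, LinearMap.zero_comp, LinearMap.comp_id,
        sub_zero]
  · have hV0 : coact ρV f₀ = 0 :=
      LinearMap.IsIdempotentElem.eq_zero_of_trace_eq_zero hVe
        (by linear_combination (h1 - hVtr) / 2)
    have hW1 : coact ρW f₀ = 1 :=
      hWe.eq_one_of_trace_eq_finrank (by linear_combination (h2 - hWtr) / 2)
    refine exists_section_of_commute hp hsurj hexact (P := coact ρU f₀) hc ?_ ?_
    · rw [hcoi, hV0, LinearMap.comp_zero]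
    · rw [← hcop, hW1, Module.End.one_eq_id, LinearMap.id_comp]

end

end
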